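/- Let 𝒢(H∪O, W) be a conditional acyclic directed graph (CADG) whose random vertices are partitioned into latent vertices H and observed vertices O. If v ∈ O is fixable in the latent projection 𝒢(O,W) = σ_H(𝒢(H∪O,W)), then σ_H(φ_v(𝒢(H∪O,W))) = φ_v(σ_H(𝒢(H∪O,W))); that is, latent projection and fixing commute. -/

import Mathlib

open scoped Classical
open Finset

namespace Nested

/-- A directed mixed graph: directed (`dir`) and bidirected (`bi`) edges. -/
structure MixedGraph (Vt : Type) where
  dir : Vt → Vt → Prop
  bi : Vt → Vt → Prop

/-- A step along a path: an edge traversed from `src` to `tgt`, with Booleans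
recording whether there is an arrowhead at the `src` (resp. `tgt`) end. -/
structure Step (Vt : Type) where
  src : Vt
  tgt : Vt
  hsrc : Bool
  htgt : Bool

/-- The step corresponds to an actual edge of the mixed graph `M`. -/
def StepIn {Vt : Type} (M : MixedGraph Vt) (s : Step Vt) : Prop :=
  (s.hsrc = false ∧ s.htgt = true ∧ M.dir s.src s.tgt) ∨
  (s.hsrc = true ∧ s.htgt = false ∧ M.dir s.tgt s.src) ∨
  (s.hsrc = true ∧ s.htgt = true ∧ M.bi s.src s.tgt)

/-- `IsWalk M a p b`: `p` is a walk in `M` from `a` to `b`. -/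
def IsWalk {Vt : Type} (M : MixedGraph Vt) : Vt → List (Step Vt) → Vt → Prop
  | a, [], b => a = b
  | a, s :: p, b => s.src = a ∧ StepIn M s ∧ IsWalk M s.tgt p b

/-- The list of vertices visited by a walk starting at `a`. -/
def wverts {Vt : Type} (a : Vt) (p : List (Step Vt)) : List Vt :=
  a :: p.map Step.tgt

/-- The non-endpoint (interior) vertices of a walk. -/
def interiorVerts {Vt : Type} (p : List (Step Vt)) : List Vt :=
  (p.map Step.tgt).dropLast

variable {Vt : Type} [Fintype Vt] [DecidableEq Vt]

/-- `z` is an ancestor (via directed edges) of some element of `C`. -/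
def ancOf (M : MixedGraph Vt) (C : Finset Vt) (z : Vt) : Prop :=
  ∃ c ∈ C, Relation.ReflTransGen M.dir z c

/-- The common vertex of two consecutive steps is a collider. -/
def Collider {Vt : Type} (s t : Step Vt) : Prop := s.htgt = true ∧ t.hsrc = true

/-- The interior vertex shared by consecutive steps `s`, `t` satisfies the
m-connection requirement given `C`: colliders are ancestors of `C`,
non-colliders lie outside `C`. -/
def jointOK (M : MixedGraph Vt) (C : Finset Vt) (s t : Step Vt) : Prop :=
  (Collider s t ∧ ancOf M C s.tgt) ∨ (¬ Collider s t ∧ s.tgt ∉ C)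

/-- `a` and `b` are m-connected given `C` in `M`: there is a path (walk with
distinct vertices) from `a` to `b` every non-collider of which avoids `C` and
every collider of which is an ancestor of `C`. -/
def MConn (M : MixedGraph Vt) (C : Finset Vt) (a b : Vt) : Prop :=
  ∃ p : List (Step Vt), IsWalk M a p b ∧ (wverts a p).Nodup ∧
    List.Chain' (jointOK M C) p

/-- m-separation of the sets `A` and `B` given `C` in `M`. -/
def MSep (M : MixedGraph Vt) (A B C : Finset Vt) : Prop :=
  ∀ a ∈ A, ∀ b ∈ B, ¬ MConn M C a b

/-- There is a directed path from `v` to `w` in `M` all of whose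
non-endpoint vertices lie in `L`. -/
def DirVia (M : MixedGraph Vt) (L : Finset Vt) (v w : Vt) : Prop :=
  ∃ p : List (Step Vt), p ≠ [] ∧ IsWalk M v p w ∧ (wverts v p).Nodup ∧
    (∀ s ∈ p, s.hsrc = false ∧ s.htgt = true) ∧
    (∀ z ∈ interiorVerts p, z ∈ L)

/-- There is a path between `v` and `w` in `M` with arrowheads at both
endpoints, all of whose non-endpoint vertices are non-colliders lying in `L`. -/
def BiVia (M : MixedGraph Vt) (L : Finset Vt) (v w : Vt) : Prop :=
  ∃ p : List (Step Vt), p ≠ [] ∧ IsWalk M v p w ∧ (wverts v p).Nodup ∧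
    (∀ s, p.head? = some s → s.hsrc = true) ∧
    (∀ s, p.getLast? = some s → s.htgt = true) ∧
    (∀ z ∈ interiorVerts p, z ∈ L) ∧
    List.Chain' (fun s t => ¬ Collider s t) p

/-- A (pre-)conditional acyclic directed mixed graph: a mixed graph together
with disjoint finite sets `V` of random and `W` of fixed vertices.  The
well-formedness conditions are collected in `PreCADMG.WF`. -/
structure PreCADMG (Vt : Type) where
  dir : Vt → Vt → Prop
  bi : Vt → Vt → Prop
  V : Finset Vt
  W : Finset Vt

/-- The underlying mixed graph of a CADMG. -/
def PreCADMG.mg {Vt : Type} (G : PreCADMG Vt) : MixedGraph Vt := ⟨G.dir, G.bi⟩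

/-- Well-formedness: `V` and `W` are disjoint, `bi` is symmetric, all edges
join vertices of `V ∪ W`, directed and bidirected edges never point into `W`,
and there are no directed cycles.  (So `WF` with `W = ∅` says: ADMG.) -/
def PreCADMG.WF {Vt : Type} (G : PreCADMG Vt) : Prop :=
  Disjoint G.V G.W ∧
  (∀ a b, G.bi a b → G.bi b a) ∧
  (∀ a b, G.dir a b → a ∈ G.V ∪ G.W ∧ b ∈ G.V) ∧
  (∀ a b, G.bi a b → a ∈ G.V ∧ b ∈ G.V) ∧
  (∀ v, ¬ Relation.TransGen G.dir v v)

/-- The district of `v`: random vertices joined to `v` by a bidirected path. -/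
noncomputable def dis (G : PreCADMG Vt) (v : Vt) : Finset Vt :=
  G.V.filter (fun w => Relation.ReflTransGen G.bi v w)

/-- The set of districts of `G`. -/
noncomputable def districts (G : PreCADMG Vt) : Finset (Finset Vt) :=
  G.V.image (dis G)

/-- Descendants of `v` (including `v` itself, among the vertices of `G`). -/
noncomputable def deF (G : PreCADMG Vt) (v : Vt) : Finset Vt :=
  (G.V ∪ G.W).filter (fun w => Relation.ReflTransGen G.dir v w)

/-- Non-descendants of `v`. -/
noncomputable def ndF (G : PreCADMG Vt) (v : Vt) : Finset Vt :=
  (G.V ∪ G.W) \ deF G v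

/-- Ancestors of the set `D` (including `D`). -/
noncomputable def anS (G : PreCADMG Vt) (D : Finset Vt) : Finset Vt :=
  (G.V ∪ G.W).filter (fun a => ∃ d ∈ D, Relation.ReflTransGen G.dir a d)

/-- Parents of the set `D`. -/
noncomputable def paS (G : PreCADMG Vt) (D : Finset Vt) : Finset Vt :=
  (G.V ∪ G.W).filter (fun a => ∃ d ∈ D, G.dir a d)

/-- Markov blanket: `mb(t) = pa(dis(t)) ∪ (dis(t) \ {t})`. -/
noncomputable def mb (G : PreCADMG Vt) (t : Vt) : Finset Vt :=
  paS G (dis G t) ∪ (dis G t).erase t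

/-- `v` is fixable in `G`: `v` is random and `dis(v) ∩ de(v) = {v}`. -/
def fixable (G : PreCADMG Vt) (v : Vt) : Prop :=
  v ∈ G.V ∧ dis G v ∩ deF G v = {v}

/-- The set `𝔽(G)` of fixable vertices. -/
noncomputable def FixF (G : PreCADMG Vt) : Finset Vt :=
  G.V.filter (fun v => fixable G v)

/-- The graph `φ_r(G)`:  `r` becomes fixed and edges with an arrowhead at `r`
are deleted. -/
def fixG (G : PreCADMG Vt) (r : Vt) : PreCADMG Vt where
  dir a b := G.dir a b ∧ b ≠ r
  bi a b := G.bi a b ∧ a ≠ r ∧ b ≠ r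
  V := G.V.erase r
  W := insert r G.W

/-- The induced subgraph on `A`, preserving random/fixed status. -/
def induce (G : PreCADMG Vt) (A : Finset Vt) : PreCADMG Vt where
  dir a b := G.dir a b ∧ a ∈ A ∧ b ∈ A
  bi a b := G.bi a b ∧ a ∈ A ∧ b ∈ A
  V := G.V ∩ A
  W := G.W ∩ A

/-- `A` is an ancestral set in `G`. -/
def Ancestral (G : PreCADMG Vt) (A : Finset Vt) : Prop :=
  A ⊆ G.V ∪ G.W ∧
  ∀ a ∈ A, ∀ b ∈ G.V ∪ G.W, Relation.ReflTransGen G.dir b a → b ∈ A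

/-- `ord` is (the rank function of) a topological total ordering for `G`:
if `a ≺ b` then `a` is not a descendant of `b`. -/
def IsTopo (G : PreCADMG Vt) (ord : Vt → ℕ) : Prop :=
  Function.Injective ord ∧
  ∀ a b, ord a < ord b → ¬ Relation.ReflTransGen G.dir b a

/-- The predecessors of `d` in the ordering `ord`. -/
noncomputable def preF (G : PreCADMG Vt) (ord : Vt → ℕ) (d : Vt) : Finset Vt :=
  (G.V ∪ G.W).filter (fun a => ord a < ord d)

/-- The graph `G^{|W}`: all pairs of fixed vertices joined by bidirected
edges. -/
def augMG (G : PreCADMG Vt) : MixedGraph Vt :=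
  ⟨G.dir, fun a b => G.bi a b ∨ (a ∈ G.W ∧ b ∈ G.W ∧ a ≠ b)⟩

/-- Adjacency in the augmented graph `(G)^a`: joined in `G^{|W}` by a path on
which every non-endpoint vertex is a collider. -/
def augEdge (G : PreCADMG Vt) (a b : Vt) : Prop :=
  a ≠ b ∧ ∃ p : List (Step Vt), p ≠ [] ∧ IsWalk (augMG G) a p b ∧
    (wverts a p).Nodup ∧ List.Chain' Collider p

/-- Undirected separation of `a` from `b` by `C` (w.r.t. adjacency `E`). -/
def USepPt (E : Vt → Vt → Prop) (C : Finset Vt) (a b : Vt) : Prop :=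
  ∀ l : List Vt, l.Chain' E → l.head? = some a → l.getLast? = some b →
    l.Nodup → ∃ v ∈ l, v ∈ C

/-- Undirected separation of `A` from `B` by `C`. -/
def USep (E : Vt → Vt → Prop) (C A B : Finset Vt) : Prop :=
  ∀ a ∈ A, ∀ b ∈ B, USepPt E C a b

/-- The latent projection of `G` obtained by projecting out the (random)
vertices in `H`. -/
def project (G : PreCADMG Vt) (H : Finset Vt) : PreCADMG Vt where
  dir v w := v ∈ (G.V \ H) ∪ G.W ∧ w ∈ G.V \ H ∧ v ≠ w ∧ DirVia G.mg H v w
  bi v w := v ∈ G.V \ H ∧ w ∈ G.V \ H ∧ v ≠ w ∧ BiVia G.mg H v w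
  V := G.V \ H
  W := G.W

/-! ## Kernels -/

variable {𝔛 : Vt → Type} [∀ v, Fintype (𝔛 v)]

/-- Sum a function of a joint state over all assignments to the coordinates in
`S`, the remaining coordinates being given by `x`. -/
noncomputable def sumOver (S : Finset Vt) (f : (∀ v, 𝔛 v) → ℝ) (x : ∀ v, 𝔛 v) : ℝ :=
  ∑ y : ((v : {v : Vt // v ∈ S}) → 𝔛 v.1),
    f (fun v => if h : v ∈ S then y ⟨v, h⟩ else x v)

/-- `f` depends only on the coordinates in `S`. -/
def DepOn (f : (∀ v, 𝔛 v) → ℝ) (S : Finset Vt) : Prop :=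
  ∀ x y : ∀ v, 𝔛 v, (∀ v ∈ S, x v = y v) → f x = f y

/-- `q` is a kernel `q_V(x_V | x_W)`: a nonnegative function of `(x_V, x_W)`
with `∑_{x_V} q_V(x_V | x_W) = 1` for every `x_W`. -/
def IsKernel (V W : Finset Vt) (q : (∀ v, 𝔛 v) → ℝ) : Prop :=
  (∀ x, 0 ≤ q x) ∧ DepOn q (V ∪ W) ∧ ∀ x, sumOver V q x = 1

/-- Case (a) of the definition of kernel conditional independence
`X_A ⫫ X_B | X_C [q_V]`:  `A ∩ W = ∅` and the conditional kernel
`q_V(x_A | x_B, x_C, x_{W∖(B∪C)})` is, wherever defined, a function of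
`x_A, x_C` only. -/
def KIndepA (V W : Finset Vt) (q : (∀ v, 𝔛 v) → ℝ) (A B C : Finset Vt) : Prop :=
  A ∩ W = ∅ ∧
  ∀ x y : ∀ v, 𝔛 v, (∀ v ∈ A ∪ C, x v = y v) →
    0 < sumOver (V \ (B ∪ C)) q x → 0 < sumOver (V \ (B ∪ C)) q y →
    sumOver (V \ (A ∪ B ∪ C)) q x / sumOver (V \ (B ∪ C)) q x =
      sumOver (V \ (A ∪ B ∪ C)) q y / sumOver (V \ (B ∪ C)) q y

/-- Kernel conditional independence `X_A ⫫ X_B | X_C [q_V]`. -/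
def KIndep (V W : Finset Vt) (q : (∀ v, 𝔛 v) → ℝ) (A B C : Finset Vt) : Prop :=
  KIndepA V W q A B C ∨ KIndepA V W q B A C

/-- The conditional kernel `q_V(x_d | x_T)` (as a function of the joint
state). -/
noncomputable def condOn (V : Finset Vt) (q : (∀ v, 𝔛 v) → ℝ) (d : Vt)
    (T : Finset Vt) : (∀ v, 𝔛 v) → ℝ :=
  fun x => sumOver (V \ insert d T) q x / sumOver (V \ T) q x

/-- The kernel `q*_{V∖H} = q_V / q_V(x_H | x_T, x_W)` obtained by fixing `H`. -/
noncomputable def qstar (V H T : Finset Vt) (q : (∀ v, 𝔛 v) → ℝ) :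
    (∀ v, 𝔛 v) → ℝ :=
  fun x => q x / (sumOver (V \ (H ∪ T)) q x / sumOver (V \ T) q x)

/-- The kernel fixing operation `φ_r(q; G) = q / q_V(x_r | x_{mb_G(r)})`. -/
noncomputable def fixK (G : PreCADMG Vt) (r : Vt) (q : (∀ v, 𝔛 v) → ℝ) :
    (∀ v, 𝔛 v) → ℝ :=
  fun x => q x / condOn G.V q r (mb G r) x

/-- The global Markov property for a CADMG (`q ∈ 𝒫^c_m(G)`). -/
def Pcm (G : PreCADMG Vt) (q : (∀ v, 𝔛 v) → ℝ) : Prop :=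
  ∀ A B C : Finset Vt, A ⊆ G.V ∪ G.W → B ⊆ G.V ∪ G.W → C ⊆ G.V ∪ G.W →
    Disjoint A B → Disjoint A C → Disjoint B C →
    MSep (augMG G) A B C → KIndep G.V G.W q A B C

/-- The augmented Markov property for a CADMG (`q ∈ 𝒫^c_a(G)`). -/
def Pca (G : PreCADMG Vt) (q : (∀ v, 𝔛 v) → ℝ) : Prop :=
  ∀ A B C : Finset Vt, A ⊆ G.V ∪ G.W → B ⊆ G.V ∪ G.W → C ⊆ G.V ∪ G.W →
    Disjoint A B → Disjoint A C → Disjoint B C →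
    USep (augEdge (induce G (anS G (A ∪ B ∪ C)))) C A B →
    KIndep G.V G.W q A B C

/-- The local Markov property for `G` at `t`. -/
def LocalAt (G : PreCADMG Vt) (q : (∀ v, 𝔛 v) → ℝ) (t : Vt) : Prop :=
  KIndep G.V G.W q {t} ((G.V ∪ G.W) \ insert t (mb G t)) (mb G t)

/-- The ordered local Markov property for a CADMG (`q ∈ 𝒫^c_l(G, ≺)`). -/
def Pcl (G : PreCADMG Vt) (ord : Vt → ℕ) (q : (∀ v, 𝔛 v) → ℝ) : Prop :=
  ∀ A : Finset Vt, Ancestral G A → ∀ m ∈ A, (∀ a ∈ A, ord a ≤ ord m) →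
    m ∈ G.V →
    LocalAt (induce G ((G.V ∩ A) ∪ G.W)) (sumOver (G.V \ A) q) m

/-- Tian factorization for a CADMG (`q ∈ 𝒫^c_f(G)`). -/
def Pcf (G : PreCADMG Vt) (q : (∀ v, 𝔛 v) → ℝ) : Prop :=
  ∀ A : Finset Vt, Ancestral G A →
    ∃ f : Finset Vt → ((∀ v, 𝔛 v) → ℝ),
      (∀ D ∈ districts (induce G A), IsKernel D (paS G D \ D) (f D)) ∧
      ∀ x, sumOver (G.V \ A) q x = ∏ D ∈ districts (induce G A), f D x

/-- `T^{(d,D)}_≺ = mb_G(d, an_G(D) ∩ pre_≺(d))`. -/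
noncomputable def Tset (G : PreCADMG Vt) (ord : Vt → ℕ) (d : Vt)
    (D : Finset Vt) : Finset Vt :=
  mb (induce G (insert d (anS G D ∩ preF G ord d))) d

/-- The district kernel
`q_D(x_D | x_{pa(D)∖D}) = ∏_{d ∈ D} q_V(x_d | x_{T^{(d,D)}_≺})`. -/
noncomputable def qD (G : PreCADMG Vt) (ord : Vt → ℕ)
    (q : (∀ v, 𝔛 v) → ℝ) (D : Finset Vt) : (∀ v, 𝔛 v) → ℝ :=
  fun x => ∏ d ∈ D, condOn G.V q d (Tset G ord d D) x

/-! ## Fixing sequences and nested Markov properties -/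

/-- Iterated graph fixing. -/
def fixGs : PreCADMG Vt → List Vt → PreCADMG Vt
  | G, [] => G
  | G, r :: rs => fixGs (fixG G r) rs

/-- Iterated kernel fixing. -/
noncomputable def fixKs : PreCADMG Vt → ((∀ v, 𝔛 v) → ℝ) → List Vt →
    ((∀ v, 𝔛 v) → ℝ)
  | _, q, [] => q
  | G, q, r :: rs => fixKs (fixG G r) (fixK G r q) rs

/-- A valid fixing sequence: each vertex is fixable when its turn comes. -/
def ValidSeq : PreCADMG Vt → List Vt → Prop
  | _, [] => True
  | G, r :: rs => fixable G r ∧ ValidSeq (fixG G r) rs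

/-- The global nested Markov property for an ADMG. -/
def NestedGlobal (G : PreCADMG Vt) (p : (∀ v, 𝔛 v) → ℝ) : Prop :=
  ∀ ws : List Vt, ValidSeq G ws → Pcm (fixGs G ws) (fixKs G p ws)

/-- `C` is intrinsic in `G`: a district of a reachable CADMG. -/
def Intrinsic (G : PreCADMG Vt) (C : Finset Vt) : Prop :=
  ∃ ws : List Vt, ws.Nodup ∧ ValidSeq G ws ∧ C ∈ districts (fixGs G ws)

/-- The ordered local nested Markov property for an ADMG. -/
def NestedLocal (G : PreCADMG Vt) (ord : Vt → ℕ) (p : (∀ v, 𝔛 v) → ℝ) : Prop :=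
  ∀ C : Finset Vt, Intrinsic G C →
    ∀ ws : List Vt, ws.Nodup → ValidSeq G ws → ws.toFinset = G.V \ C →
      ∀ m ∈ C, (∀ c ∈ C, ord c ≤ ord m) →
        LocalAt (fixGs G ws) (fixKs G p ws) m

end Nested

namespace Nested

lemma stepIn_fixG_iff {Vt : Type} [DecidableEq Vt] (G : PreCADMG Vt) (v : Vt) (s : Step Vt) :
    StepIn (fixG G v).mg s ↔ StepIn G.mg s ∧
      (s.hsrc = true → s.src ≠ v) ∧ (s.htgt = true → s.tgt ≠ v) := by
  rcases s with ⟨a, b, _ | _, _ | _⟩ <;> simp [StepIn, PreCADMG.mg, fixG]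

/-- Walks in `φ_v(G)` are the walks in `G` without an arrowhead at `v`. -/
lemma isWalk_fixG_iff {Vt : Type} [DecidableEq Vt] (G : PreCADMG Vt) (v a b : Vt)
    (p : List (Step Vt)) :
    IsWalk (fixG G v).mg a p b ↔ IsWalk G.mg a p b ∧
      ∀ s ∈ p, (s.hsrc = true → s.src ≠ v) ∧ (s.htgt = true → s.tgt ≠ v) := by
  induction p generalizing a with
  | nil => simp [IsWalk]
  | cons s p ih =>
    simp only [IsWalk, ih, stepIn_fixG_iff, List.forall_mem_cons]
    tauto

lemma IsWalk.tgt_eq_or_mem_interiorVerts {Vt : Type} {M : MixedGraph Vt} {a b : Vt}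
    {p : List (Step Vt)} (hp : IsWalk M a p b) {s : Step Vt} (hs : s ∈ p) :
    s.tgt = b ∨ s.tgt ∈ interiorVerts p := by
  induction p generalizing a with
  | nil => simp at hs
  | cons t p ih =>
    obtain ⟨-, -, hp⟩ := hp
    cases p with
    | nil =>
      obtain rfl : s = t := by simpa using hs
      exact Or.inl hp
    | cons u q =>
      rcases List.mem_cons.1 hs with rfl | hs
      · exact Or.inr (by simp [interiorVerts])
      · exact (ih hp hs).imp_right fun h => List.mem_cons_of_mem _ h

lemma IsWalk.src_eq_or_mem_interiorVerts {Vt : Type} {M : MixedGraph Vt} {a b : Vt}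
    {p : List (Step Vt)} (hp : IsWalk M a p b) {s : Step Vt} (hs : s ∈ p) :
    s.src = a ∨ s.src ∈ interiorVerts p := by
  induction p generalizing a with
  | nil => simp at hs
  | cons t p ih =>
    obtain ⟨ht, -, hp⟩ := hp
    cases p with
    | nil =>
      obtain rfl : s = t := by simpa using hs
      exact Or.inl ht
    | cons u q =>
      rcases List.mem_cons.1 hs with rfl | hs
      · exact Or.inl ht
      · rcases ih hp hs with h | h
        · exact Or.inr (by simp [interiorVerts, h])
        · exact Or.inr (List.mem_cons_of_mem _ h)

lemma dirVia_fixG_iff {Vt : Type} [DecidableEq Vt] (G : PreCADMG Vt) {H : Finset Vt}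
    {v a b : Vt} (hv : v ∉ H) (hb : b ≠ v) :
    DirVia (fixG G v).mg H a b ↔ DirVia G.mg H a b := by
  refine exists_congr fun p => ?_
  rw [isWalk_fixG_iff]
  constructor
  · rintro ⟨h₁, ⟨h₂, -⟩, h₃⟩
    exact ⟨h₁, h₂, h₃⟩
  · rintro ⟨h₁, h₂, h₃, h₄, h₅⟩
    refine ⟨h₁, ⟨h₂, fun s hs => ⟨fun h => ?_, fun _ h => ?_⟩⟩, h₃, h₄, h₅⟩
    · simp [(h₄ s hs).1] at h
    · rcases h₂.tgt_eq_or_mem_interiorVerts hs with h' | h'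
      · exact hb (h'.symm.trans h)
      · exact hv (h ▸ h₅ _ h')

lemma biVia_fixG_iff {Vt : Type} [DecidableEq Vt] (G : PreCADMG Vt) {H : Finset Vt}
    {v a b : Vt} (hv : v ∉ H) (ha : a ≠ v) (hb : b ≠ v) :
    BiVia (fixG G v).mg H a b ↔ BiVia G.mg H a b := by
  refine exists_congr fun p => ?_
  rw [isWalk_fixG_iff]
  constructor
  · rintro ⟨h₁, ⟨h₂, -⟩, h₃⟩
    exact ⟨h₁, h₂, h₃⟩
  · rintro ⟨h₁, h₂, h₃, h₄, h₅, h₆, h₇⟩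
    refine ⟨h₁, ⟨h₂, fun s hs => ⟨fun _ h => ?_, fun _ h => ?_⟩⟩, h₃, h₄, h₅, h₆, h₇⟩
    · rcases h₂.src_eq_or_mem_interiorVerts hs with h' | h'
      · exact ha (h'.symm.trans h)
      · exact hv (h ▸ h₆ _ h')
    · rcases h₂.tgt_eq_or_mem_interiorVerts hs with h' | h'
      · exact hb (h'.symm.trans h)
      · exact hv (h ▸ h₆ _ h')

/-- Latent projection commutes with fixing any observed random vertex. -/
lemma project_fixG {Vt : Type} [Fintype Vt] [DecidableEq Vt] (G : PreCADMG Vt)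
    {H : Finset Vt} {v : Vt} (hvG : v ∈ G.V) (hvH : v ∉ H) :
    project (fixG G v) H = fixG (project G H) v := by
  have hdir : ∀ a b, (project (fixG G v) H).dir a b ↔ (fixG (project G H) v).dir a b := by
    intro a b
    by_cases hb : b = v
    · simp [project, fixG, hb]
    · have hmem : a ∈ ((fixG G v).V \ H) ∪ (fixG G v).W ↔ a ∈ (G.V \ H) ∪ G.W := by
        by_cases ha : a = v <;> simp [fixG, ha, hvG, hvH]
      have hmem' : b ∈ (fixG G v).V \ H ↔ b ∈ G.V \ H := by simp [fixG, hb]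
      change (_ ∧ _ ∧ _ ∧ DirVia (fixG G v).mg H a b) ↔ (_ ∧ _ ∧ _ ∧ DirVia G.mg H a b) ∧ b ≠ v
      rw [hmem, hmem', dirVia_fixG_iff G hvH hb]
      tauto
  have hbi : ∀ a b, (project (fixG G v) H).bi a b ↔ (fixG (project G H) v).bi a b := by
    intro a b
    by_cases ha : a = v
    · simp [project, fixG, ha]
    by_cases hb : b = v
    · simp [project, fixG, hb]
    have hmem : ∀ c, c ≠ v → (c ∈ (fixG G v).V \ H ↔ c ∈ G.V \ H) := fun c hc => by
      simp [fixG, hc]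
    change (_ ∧ _ ∧ _ ∧ BiVia (fixG G v).mg H a b) ↔
      (_ ∧ _ ∧ _ ∧ BiVia G.mg H a b) ∧ a ≠ v ∧ b ≠ v
    rw [hmem a ha, hmem b hb, biVia_fixG_iff G hvH ha hb]
    tauto
  have hV : (project (fixG G v) H).V = (fixG (project G H) v).V :=
    Finset.erase_sdiff_comm _ _ _
  calc project (fixG G v) H
      = ⟨(project (fixG G v) H).dir, (project (fixG G v) H).bi,
          (project (fixG G v) H).V, insert v G.W⟩ := rfl
    _ = fixG (project G H) v := by
      rw [funext₂ fun a b => propext (hdir a b), funext₂ fun a b => propext (hbi a b), hV]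
      rfl

end Nested

open Nested in
/-- let `𝒢(H∪O, W)` be a CADG (a CADMG with no bidirected
edges) whose random vertices are partitioned into latent `H` and observed
`O`.  If `v ∈ O` is fixable in the latent projection
`𝒢(O,W) = σ_H(𝒢(H∪O,W))`, then latent projection and fixing commute:
`σ_H(φ_v(𝒢(H∪O,W))) = φ_v(σ_H(𝒢(H∪O,W)))`. -/
theorem projection_fixing_commute
    {Vt : Type} [Fintype Vt] [DecidableEq Vt]
    (G : PreCADMG Vt) (hWF : G.WF) (hCADG : ∀ a b, ¬ G.bi a b)
    (H O : Finset Vt) (hpart : G.V = H ∪ O) (hdisj : Disjoint H O)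
    (v : Vt) (hv : v ∈ O) (hfix : fixable (project G H) v) :
    project (fixG G v) H = fixG (project G H) v := by
  exact project_fixG G (hpart ▸ Finset.mem_union_right H hv)
    (Finset.disjoint_right.1 hdisj hv)
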